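/- Let y_1,…,y_N be distinct points of ℝ³ and α_1,…,α_N ∈ ℝ. Then for every real k > 0 the N×N complex matrix Γ_{α,Y}(k) with entries (α_j − ik/(4π))δ_{jℓ} − (e^{ik|y_j−y_ℓ|}/(4π|y_j−y_ℓ|))(1 − δ_{jℓ}) is invertible (its determinant is nonzero). -/

import Mathlib

open MeasureTheory Complex Filter Topology Set

noncomputable section

/-- Euclidean space `ℝ³`. -/
abbrev R3 := EuclideanSpace ℝ (Fin 3)

lemma slice_integral (f : ℝ → ℝ) (hf : Continuous f) (R : ℝ) (hR : 0 < R) :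
    ∫ ξ in Metric.ball (0 : R3) R, f (ξ 0) =
      ∫ s in (-R)..R, Real.pi * (R ^ 2 - s ^ 2) * f s := by
  let e : ℝ × EuclideanSpace ℝ (Fin 2) ≃ᵐ R3 :=
    ((MeasurableEquiv.refl ℝ).prodCongr (MeasurableEquiv.toLp 2 (Fin 2 → ℝ)).symm).trans
      ((MeasurableEquiv.piFinSuccAbove (fun _ : Fin 3 => ℝ) 0).symm.trans
        (MeasurableEquiv.toLp 2 (Fin 3 → ℝ)))
  have he : MeasurePreserving e (volume.prod volume) volume := by
    refine MeasurePreserving.trans (μb := (volume : Measure (ℝ × (Fin 2 → ℝ)))) ?_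
      (MeasurePreserving.trans
        ((volume_preserving_piFinSuccAbove (fun _ : Fin 3 => ℝ) 0).symm _)
        (PiLp.volume_preserving_toLp (Fin 3)))
    exact (MeasurePreserving.id volume).prod (PiLp.volume_preserving_ofLp (Fin 2))
  have h0 : ∀ p, (e p) 0 = p.1 := fun p => rfl
  have h1 : ∀ p, (e p) 1 = p.2 0 := fun p => rfl
  have h2 : ∀ p, (e p) 2 = p.2 1 := fun p => rfl
  have hball : ∀ p, e p ∈ Metric.ball (0 : R3) R ↔ p.1 ^ 2 + ‖p.2‖ ^ 2 < R ^ 2 := by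
    intro p
    rw [mem_ball_zero_iff, ← sq_lt_sq₀ (norm_nonneg _) hR.le, EuclideanSpace.norm_sq_eq,
      EuclideanSpace.norm_sq_eq]
    simp [Fin.sum_univ_succ, h0, h1, h2]
  have hint : Integrable ((Metric.ball (0 : R3) R).indicator (fun ξ : R3 => f (ξ 0))) := by
    rw [integrable_indicator_iff measurableSet_ball]
    have hc : Continuous (fun ξ : R3 => f (ξ 0)) := by fun_prop
    exact (hc.continuousOn.integrableOn_compact (isCompact_closedBall (0 : R3) R)).mono_set
      Metric.ball_subset_closedBall
  rw [← integral_indicator measurableSet_ball, ← he.integral_comp' , integral_prod]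
  · have key : ∀ s : ℝ, ∫ w, (Metric.ball (0 : R3) R).indicator (fun ξ : R3 => f (ξ 0)) (e (s, w))
        = (Set.Ioc (-R) R).indicator (fun s => Real.pi * (R ^ 2 - s ^ 2) * f s) s := by
      intro s
      have e1 : (fun w => (Metric.ball (0 : R3) R).indicator (fun ξ : R3 => f (ξ 0)) (e (s, w)))
        = {w : EuclideanSpace ℝ (Fin 2) | s ^ 2 + ‖w‖ ^ 2 < R ^ 2}.indicator (fun _ => f s) := by
        funext w
        by_cases hw : e (s, w) ∈ Metric.ball (0 : R3) R
        · have hw' : w ∈ {w : EuclideanSpace ℝ (Fin 2) | s ^ 2 + ‖w‖ ^ 2 < R ^ 2} := (hball _).1 hw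
          rw [Set.indicator_of_mem hw, Set.indicator_of_mem hw', h0]
        · have hw' : w ∉ {w : EuclideanSpace ℝ (Fin 2) | s ^ 2 + ‖w‖ ^ 2 < R ^ 2} :=
            fun h => hw ((hball _).2 h)
          rw [Set.indicator_of_notMem hw, Set.indicator_of_notMem hw']
      rw [e1]
      by_cases hs : s ∈ Set.Ioc (-R) R
      · rw [Set.indicator_of_mem hs]
        have hnn : 0 ≤ R ^ 2 - s ^ 2 := by nlinarith [hs.1, hs.2]
        have e2 : {w : EuclideanSpace ℝ (Fin 2) | s ^ 2 + ‖w‖ ^ 2 < R ^ 2} =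
            Metric.ball 0 (Real.sqrt (R ^ 2 - s ^ 2)) := by
          ext w
          rw [mem_ball_zero_iff, Real.lt_sqrt (norm_nonneg _), Set.mem_ofPred_eq]
          constructor <;> intro h <;> linarith
        rw [e2, integral_indicator measurableSet_ball, setIntegral_const, measureReal_def,
          EuclideanSpace.volume_ball_fin_two]
        rw [← ENNReal.ofReal_pow (Real.sqrt_nonneg _), Real.sq_sqrt hnn]
        rw [ENNReal.toReal_mul, ENNReal.toReal_ofReal hnn, smul_eq_mul]
        rw [ENNReal.toReal_ofReal Real.pi_pos.le]
        ring
      · rw [Set.indicator_of_notMem hs]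
        have e2 : {w : EuclideanSpace ℝ (Fin 2) | s ^ 2 + ‖w‖ ^ 2 < R ^ 2} = ∅ := by
          ext w
          simp only [Set.mem_ofPred_eq, Set.mem_empty_iff_false, iff_false, not_lt]
          have : R ^ 2 ≤ s ^ 2 := by
            rw [Set.mem_Ioc, not_and_or] at hs
            rcases hs with hs | hs <;> nlinarith
          nlinarith [sq_nonneg ‖w‖]
        rw [e2]; simp
    simp_rw [key]
    rw [integral_indicator measurableSet_Ioc, intervalIntegral.integral_of_le (by linarith)]
  · exact (he.integrable_comp_emb e.measurableEmbedding).2 hint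

lemma cos_ball (x : R3) (R : ℝ) (hR : 0 < R) :
    ∫ ξ in Metric.ball (0 : R3) R, Real.cos (inner ℝ x ξ) =
      ∫ s in (-R)..R, Real.pi * (R ^ 2 - s ^ 2) * Real.cos (‖x‖ * s) := by
  rw [← slice_integral (fun s => Real.cos (‖x‖ * s)) (by fun_prop) R hR]
  let w : R3 := EuclideanSpace.single 0 ‖x‖
  have hw : ‖x‖ = ‖w‖ := by simp [w]
  let A := (ℝ ∙ (x - w))ᗮ.reflection
  have hA : A x = w := Submodule.reflection_sub hw
  have hmp := A.measurePreserving
  symm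
  rw [← hmp.setIntegral_preimage_emb A.toHomeomorph.measurableEmbedding]
  have : A ⁻¹' Metric.ball 0 R = Metric.ball 0 R := by
    ext ξ; simp
  rw [this]
  congr 1
  funext ξ
  congr 1
  symm
  have hAξ : inner ℝ x ξ = inner ℝ w (A ξ) := by rw [← hA, A.inner_map_map]
  rw [hAξ]
  simp [w, EuclideanSpace.inner_single_left]

lemma hasDerivAt_cos_ball (x : R3) (k : ℝ) (hk : 0 < k) :
    HasDerivAt (fun R => ∫ ξ in Metric.ball (0 : R3) R, Real.cos (inner ℝ x ξ))
      (4 * Real.pi * k ^ 2 * Real.sinc (k * ‖x‖)) k := by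
  set r := ‖x‖
  have ev : (fun R => ∫ ξ in Metric.ball (0 : R3) R, Real.cos (inner ℝ x ξ)) =ᶠ[𝓝 k]
      fun R => Real.pi * (R ^ 2 * ((∫ s in (0:ℝ)..R, Real.cos (r * s)) -
          ∫ s in (0:ℝ)..(-R), Real.cos (r * s)) -
        ((∫ s in (0:ℝ)..R, s ^ 2 * Real.cos (r * s)) -
          ∫ s in (0:ℝ)..(-R), s ^ 2 * Real.cos (r * s))) := by
    filter_upwards [lt_mem_nhds hk] with R hR
    have i1 : ∀ a b, IntervalIntegrable (fun s => Real.cos (r * s)) volume a b := fun a b =>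
      Continuous.intervalIntegrable (by fun_prop) _ _
    have i2 : ∀ a b, IntervalIntegrable (fun s => s ^ 2 * Real.cos (r * s)) volume a b := fun a b =>
      Continuous.intervalIntegrable (by fun_prop) _ _
    rw [cos_ball x R hR, intervalIntegral.integral_interval_sub_left (i1 _ _) (i1 _ _),
      intervalIntegral.integral_interval_sub_left (i2 _ _) (i2 _ _),
      ← intervalIntegral.integral_const_mul, ← intervalIntegral.integral_sub ((i1 _ _).const_mul _)
      (i2 _ _), ← intervalIntegral.integral_const_mul]
    congr 1
    funext s
    ring
  refine HasDerivAt.congr_of_eventuallyEq ?_ ev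
  have d : ∀ f : ℝ → ℝ, Continuous f → ∀ t, HasDerivAt (fun R => ∫ s in (0:ℝ)..R, f s) (f t) t :=
    fun f hf t => intervalIntegral.integral_hasDerivAt_right (hf.intervalIntegrable _ _)
      (hf.stronglyMeasurableAtFilter _ _) hf.continuousAt
  have d' : ∀ f : ℝ → ℝ, Continuous f → ∀ t,
      HasDerivAt (fun R => ∫ s in (0:ℝ)..(-R), f s) (-f (-t)) t := fun f hf t => by
    have := (d f hf (-t)).scomp t (hasDerivAt_neg t)
    simpa using! this
  have c1 : Continuous fun s : ℝ => Real.cos (r * s) := by fun_prop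
  have c2 : Continuous fun s : ℝ => s ^ 2 * Real.cos (r * s) := by fun_prop
  have D := ((((hasDerivAt_pow 2 k).mul ((d _ c1 k).sub (d' _ c1 k))).sub
    ((d _ c2 k).sub (d' _ c2 k))).const_mul Real.pi)
  refine D.congr_deriv ?_
  have hI : (∫ s in (0:ℝ)..k, Real.cos (r * s)) - (∫ s in (0:ℝ)..(-k), Real.cos (r * s))
      = 2 * k * Real.sinc (k * r) := by
    by_cases hr : r = 0
    · simp [hr]; ring
    · rw [intervalIntegral.integral_comp_mul_left _ hr, intervalIntegral.integral_comp_mul_left _ hr,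
        Real.sinc_of_ne_zero (by positivity)]
      simp
      field_simp
      ring_nf
  simp only [Pi.sub_apply]
  rw [hI]
  simp
  ring

lemma exists_sphere_ne (N : ℕ) (y : Fin N → R3) (hy : Function.Injective y)
    (a : Fin N → ℝ) (ha : a ≠ 0) (k : ℝ) (hk : 0 < k) :
    ∃ ξ : R3, ‖ξ‖ = k ∧ ∑ j, (a j : ℂ) * Complex.exp (Complex.I * (inner ℝ (y j) ξ : ℝ)) ≠ 0 := by
  by_contra hcon
  push Not at hcon
  -- a unit direction separating the points
  obtain ⟨v, hv1, hv⟩ : ∃ v : R3, ‖v‖ = 1 ∧ ∀ i j, i ≠ j → inner ℝ (y i) v ≠ inner ℝ (y j) v := by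
    obtain ⟨g, hg⟩ := Module.exists_dual_forall_apply_ne_zero (K := ℝ)
      (fun o : Option {p : Fin N × Fin N // p.1 ≠ p.2} =>
        o.elim (EuclideanSpace.single (0 : Fin 3) (1 : ℝ)) (fun p => y p.1.1 - y p.1.2)) (by
        rintro (_ | ⟨p, hp⟩)
        · simp
        · simpa [sub_eq_zero] using fun h => hp (hy h))
    let v := (InnerProductSpace.toDual ℝ R3).symm (LinearMap.toContinuousLinearMap g)
    have hvg : ∀ x, inner ℝ v x = g x := fun x => by simp [v]
    have hv0 : v ≠ 0 := by
      intro h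
      have := hg none
      rw [← hvg, h] at this
      simp at this
    have hn : ‖v‖ ≠ 0 := norm_ne_zero_iff.2 hv0
    refine ⟨‖v‖⁻¹ • v, ?_, ?_⟩
    · rw [norm_smul]; simp [hn]
    · intro i j hij h
      have := hg (some ⟨(i, j), hij⟩)
      rw [inner_smul_right, inner_smul_right] at h
      have h2 := mul_left_cancel₀ (inv_ne_zero hn) h
      apply this
      simp only [Option.elim, ← hvg]
      rw [real_inner_comm, inner_sub_left, h2, sub_self]
  obtain ⟨u, hu1, huv⟩ : ∃ u : R3, ‖u‖ = 1 ∧ inner ℝ u v = 0 := by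
    have hv0 : v ≠ 0 := by
      rintro rfl
      simp at hv1
    have hf : 0 < Module.finrank ℝ (ℝ ∙ v)ᗮ := by
      have h1 := (ℝ ∙ v).finrank_add_finrank_orthogonal
      rw [finrank_span_singleton hv0] at h1
      simp at h1
      omega
    have := Module.nontrivial_of_finrank_pos hf
    obtain ⟨u, hu⟩ := exists_ne (0 : (ℝ ∙ v)ᗮ)
    have hu0 : ‖(u : R3)‖ ≠ 0 := by simpa using hu
    have huv := Submodule.mem_orthogonal_singleton_iff_inner_left.1 u.2
    refine ⟨‖(u : R3)‖⁻¹ • (u : R3), ?_, ?_⟩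
    · rw [norm_smul, norm_inv, norm_norm, inv_mul_cancel₀ hu0]
    · rw [inner_smul_left, huv, mul_zero]
  let p : Fin N → ℝ := fun j => inner ℝ (y j) u
  let q : Fin N → ℝ := fun j => inner ℝ (y j) v
  let F : ℂ → ℂ := fun z => ∑ j, (a j : ℂ) *
    Complex.exp (Complex.I * (k * (p j * Complex.cos z + q j * Complex.sin z)))
  have hFd : Differentiable ℂ F := by fun_prop
  have hFr : ∀ t : ℝ, F t = 0 := by
    intro t
    have := hcon (k • (Real.cos t • u + Real.sin t • v)) (by
      rw [norm_smul, Real.norm_of_nonneg hk.le]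
      have : ‖Real.cos t • u + Real.sin t • v‖ ^ 2 = 1 := by
        rw [norm_add_sq_real, norm_smul, norm_smul, inner_smul_left, inner_smul_right, huv, hu1, hv1]
        simp
      rw [(pow_eq_one_iff_of_nonneg (norm_nonneg _) two_ne_zero).1 this, mul_one])
    rw [← this]
    simp only [F]
    refine Finset.sum_congr rfl fun j _ => ?_
    simp only [inner_smul_right, inner_add_right, p, q]
    push_cast
    congr 3
    ring
  have hF0 : F = fun _ => 0 := by
    have hA : AnalyticOnNhd ℂ F univ := fun z _ => hFd.analyticAt z
    refine hA.eq_of_frequently_eq (z₀ := 0) analyticOnNhd_const ?_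
    have ht : Tendsto (fun t : ℝ => (t : ℂ)) (𝓝[≠] 0) (𝓝[≠] 0) := by
      refine tendsto_nhdsWithin_iff.2 ⟨?_, ?_⟩
      · exact (Complex.continuous_ofReal.tendsto' 0 0 (by simp)).mono_left nhdsWithin_le_nhds
      · filter_upwards [self_mem_nhdsWithin] with t ht
        simpa using ht
    exact ht.frequently (Eventually.of_forall hFr).frequently
  -- dominant term
  obtain ⟨j0, hj0⟩ := Function.ne_iff.1 ha
  obtain ⟨m, hm, hmin⟩ := Finset.exists_min_image (Finset.univ.filter fun j => a j ≠ 0) q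
    ⟨j0, by simpa using hj0⟩
  have hm' : a m ≠ 0 := by simpa using hm
  have hz : ∀ t : ℝ, ∑ j, (a j : ℂ) * Complex.exp
      (((-(k * (q j - q m) * Real.sinh t) : ℝ) : ℂ) + ((k * (p j - p m) * Real.cosh t : ℝ) : ℂ) * I) = 0 := by
    intro t
    have h := congrFun hF0 (t * I)
    simp only [F] at h
    have h2 := congrArg (· * Complex.exp (((k * q m * Real.sinh t : ℝ) : ℂ)
      - ((k * p m * Real.cosh t : ℝ) : ℂ) * I)) h
    simp only [zero_mul, Finset.sum_mul] at h2
    rw [← h2]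
    refine Finset.sum_congr rfl fun j _ => ?_
    rw [mul_assoc (a j : ℂ), ← Complex.exp_add, Complex.cos_mul_I, Complex.sin_mul_I]
    congr 2
    push_cast
    linear_combination (-(k:ℂ) * q j * Complex.sinh t) * Complex.I_sq
  have hlim : Tendsto (fun t : ℝ => ∑ j, (a j : ℂ) * Complex.exp
      (((-(k * (q j - q m) * Real.sinh t) : ℝ) : ℂ) + ((k * (p j - p m) * Real.cosh t : ℝ) : ℂ) * I))
      atTop (𝓝 (∑ j, if j = m then (a m : ℂ) else 0)) := by
    refine tendsto_finsetSum _ fun j _ => ?_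
    by_cases hjm : j = m
    · subst hjm; simp
    · rw [if_neg hjm]
      by_cases haj : a j = 0
      · simp [haj]
      · have hlt : q m < q j := lt_of_le_of_ne (hmin j (by simpa using haj)) (hv m j (Ne.symm hjm))
        rw [tendsto_zero_iff_norm_tendsto_zero]
        have hs : Tendsto Real.sinh atTop atTop := by
          refine tendsto_atTop_mono' _ ?_ tendsto_id
          filter_upwards [eventually_ge_atTop 0] with t ht
          exact Real.self_le_sinh_iff.2 ht
        have : Tendsto (fun t : ℝ => |a j| * Real.exp (-(k * (q j - q m) * Real.sinh t))) atTop (𝓝 (|a j| * 0)) := by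
          refine Tendsto.const_mul _ (Real.tendsto_exp_neg_atTop_nhds_zero.comp ?_)
          exact hs.const_mul_atTop (mul_pos hk (sub_pos.2 hlt))
        rw [mul_zero] at this
        refine this.congr fun t => ?_
        rw [norm_mul, Complex.norm_exp, Complex.add_re, Complex.ofReal_re, Complex.re_ofReal_mul,
          Complex.I_re, mul_zero, add_zero, Complex.norm_real, Real.norm_eq_abs]
  simp_rw [hz] at hlim
  have := tendsto_nhds_unique hlim tendsto_const_nhds
  simp at this
  exact hm' this

open scoped Pointwise in
lemma deriv_ball_pos (W : R3 → ℝ) (hW : Continuous W) (hW0 : ∀ ξ, 0 ≤ W ξ) (k : ℝ) (hk : 0 < k)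
    (ξ₀ : R3) (hξ : ‖ξ₀‖ = k) (hpos : 0 < W ξ₀) (d : ℝ)
    (hd : HasDerivAt (fun R => ∫ ξ in Metric.ball (0 : R3) R, W ξ) d k) : 0 < d := by
  obtain ⟨ε, hε, hball⟩ := Metric.eventually_nhds_iff_ball.1
    (hW.continuousAt.eventually (lt_mem_nhds (half_lt_self hpos)))
  set δ := W ξ₀ / 2 with hδ
  have hδ0 : 0 < δ := by positivity
  let C : Set R3 := {ξ | ‖k • ξ - ‖ξ‖ • ξ₀‖ < (ε / 4) * ‖ξ‖}
  have hCo : IsOpen C := isOpen_lt (by fun_prop) (by fun_prop)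
  have hint : ∀ R, IntegrableOn W (Metric.ball 0 R) := fun R =>
    (hW.continuousOn.integrableOn_compact (isCompact_closedBall (0 : R3) R)).mono_set
      Metric.ball_subset_closedBall
  let V : ℝ := volume.real (C ∩ Metric.ball 0 1)
  have hV : 0 < V := by
    have hne : (C ∩ Metric.ball 0 1).Nonempty := by
      refine ⟨(2 * k)⁻¹ • ξ₀, ?_, ?_⟩
      · have hn : ‖(2 * k)⁻¹ • ξ₀‖ = 2⁻¹ := by
          rw [norm_smul, hξ, Real.norm_of_nonneg (by positivity)]; field_simp
        change ‖k • ((2 * k)⁻¹ • ξ₀) - ‖(2 * k)⁻¹ • ξ₀‖ • ξ₀‖ < (ε / 4) * ‖(2 * k)⁻¹ • ξ₀‖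
        rw [hn, smul_smul]
        have : k * (2 * k)⁻¹ = 2⁻¹ := by field_simp
        rw [this, sub_self, norm_zero]
        positivity
      · rw [mem_ball_zero_iff, norm_smul, hξ, Real.norm_of_nonneg (by positivity)]
        field_simp
        norm_num
    exact ENNReal.toReal_pos ((hCo.inter Metric.isOpen_ball).measure_pos volume hne).ne'
      (measure_ne_top_of_subset Set.inter_subset_right measure_ball_lt_top.ne)
  have hvol : ∀ R, 0 < R → volume.real (C ∩ Metric.ball 0 R) = R ^ 3 * V := by
    intro R hR
    have hset : C ∩ Metric.ball 0 R = R • (C ∩ Metric.ball 0 1) := by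
      ext ξ
      rw [Set.mem_smul_set_iff_inv_smul_mem₀ hR.ne']
      have hRi : 0 < R⁻¹ := inv_pos.2 hR
      have hn : ‖R⁻¹ • ξ‖ = R⁻¹ * ‖ξ‖ := by rw [norm_smul, Real.norm_of_nonneg hRi.le]
      refine and_congr ?_ ?_
      · change ‖k • ξ - ‖ξ‖ • ξ₀‖ < (ε / 4) * ‖ξ‖ ↔
          ‖k • (R⁻¹ • ξ) - ‖R⁻¹ • ξ‖ • ξ₀‖ < (ε / 4) * ‖R⁻¹ • ξ‖
        have : k • (R⁻¹ • ξ) - ‖R⁻¹ • ξ‖ • ξ₀ = R⁻¹ • (k • ξ - ‖ξ‖ • ξ₀) := by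
          rw [hn, smul_sub, smul_smul, smul_smul, smul_smul, mul_comm k]
        rw [this, hn, norm_smul, Real.norm_of_nonneg hRi.le, mul_left_comm,
          mul_lt_mul_iff_right₀ hRi]
      · rw [mem_ball_zero_iff, mem_ball_zero_iff, hn, inv_mul_lt_iff₀ hR, mul_one]
    rw [hset, measureReal_def, Measure.addHaar_smul, ENNReal.toReal_mul,
      ENNReal.toReal_ofReal (abs_nonneg _)]
    simp [V, measureReal_def, abs_of_pos hR]
  have hlow : ∀ᶠ R in 𝓝[>] k, δ * (3 * k ^ 2 * V) ≤
      slope (fun R => ∫ ξ in Metric.ball (0 : R3) R, W ξ) k R := by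
    have hlt : k < min (2 * k) (k + ε / 2) := lt_min (by linarith) (by linarith)
    filter_upwards [Ioo_mem_nhdsGT hlt] with R hR
    have hkR : k < R := hR.1
    have hR2 : R < 2 * k := lt_of_lt_of_le hR.2 (min_le_left _ _)
    have hR3 : R < k + ε / 2 := lt_of_lt_of_le hR.2 (min_le_right _ _)
    have hsub : Metric.ball (0 : R3) k ⊆ Metric.ball 0 R := Metric.ball_subset_ball hkR.le
    have hdiff := setIntegral_sdiff (f := W) (μ := volume) measurableSet_ball (hint R) hsub
    have hS : (C ∩ Metric.ball 0 R) \ (C ∩ Metric.ball 0 k) ⊆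
        Metric.ball 0 R \ Metric.ball 0 k := fun ξ h => ⟨h.1.2, fun h' => h.2 ⟨h.1.1, h'⟩⟩
    have hm : MeasurableSet ((C ∩ Metric.ball 0 R) \ (C ∩ Metric.ball 0 k)) :=
      (hCo.measurableSet.inter measurableSet_ball).diff (hCo.measurableSet.inter measurableSet_ball)
    have hfin : volume (C ∩ Metric.ball 0 R) ≠ ⊤ :=
      measure_ne_top_of_subset Set.inter_subset_right measure_ball_lt_top.ne
    have hvS : volume.real ((C ∩ Metric.ball 0 R) \ (C ∩ Metric.ball 0 k)) = (R ^ 3 - k ^ 3) * V := by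
      rw [measureReal_sdiff (Set.inter_subset_inter_right _ hsub)
        (hCo.measurableSet.inter measurableSet_ball)
        (measure_ne_top_of_subset Set.inter_subset_right measure_ball_lt_top.ne), hvol R (hk.trans hkR), hvol k hk]
      ring
    have h1 : δ * volume.real ((C ∩ Metric.ball 0 R) \ (C ∩ Metric.ball 0 k)) ≤
        ∫ ξ in (C ∩ Metric.ball 0 R) \ (C ∩ Metric.ball 0 k), W ξ := by
      refine setIntegral_ge_of_const_le_real hm
        (measure_ne_top_of_subset Set.sdiff_subset hfin) ?_
        ((hint R).mono_set (hS.trans Set.sdiff_subset))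
      intro ξ h
      refine (hball ξ ?_).le
      have hξC : ‖k • ξ - ‖ξ‖ • ξ₀‖ < (ε / 4) * ‖ξ‖ := h.1.1
      have hξR : ‖ξ‖ < R := mem_ball_zero_iff.1 h.1.2
      have hξk : k ≤ ‖ξ‖ := not_lt.1 fun h' => h.2 ⟨h.1.1, mem_ball_zero_iff.2 h'⟩
      rw [mem_ball_iff_norm]
      have e1 : k • (ξ - ξ₀) = (k • ξ - ‖ξ‖ • ξ₀) + (‖ξ‖ - k) • ξ₀ := by module
      have e2 : k * ‖ξ - ξ₀‖ ≤ ‖k • ξ - ‖ξ‖ • ξ₀‖ + (‖ξ‖ - k) * k := by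
        have := norm_add_le (k • ξ - ‖ξ‖ • ξ₀) ((‖ξ‖ - k) • ξ₀)
        rw [← e1, norm_smul, norm_smul, hξ, Real.norm_of_nonneg hk.le,
          Real.norm_of_nonneg (by linarith : 0 ≤ ‖ξ‖ - k)] at this
        exact this
      have e3 : (ε / 4) * ‖ξ‖ ≤ (ε / 4) * (2 * k) :=
        mul_le_mul_of_nonneg_left (by linarith) (by positivity)
      have e4 : (‖ξ‖ - k) * k < ε / 2 * k := mul_lt_mul_of_pos_right (by linarith) hk
      have e5 : k * ‖ξ - ξ₀‖ < k * ε := by nlinarith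
      exact lt_of_mul_lt_mul_left e5 hk.le
    have h2 : ∫ ξ in (C ∩ Metric.ball 0 R) \ (C ∩ Metric.ball 0 k), W ξ ≤
        ∫ ξ in Metric.ball 0 R \ Metric.ball 0 k, W ξ :=
      setIntegral_mono_set ((hint R).mono_set Set.sdiff_subset) (ae_of_all _ hW0)
        (LE.le.eventuallyLE hS)
    rw [hdiff] at h2
    rw [hvS] at h1
    rw [slope_def_field, le_div_iff₀ (by linarith)]
    refine le_trans ?_ (h1.trans h2)
    have : 3 * k ^ 2 * (R - k) ≤ R ^ 3 - k ^ 3 := by nlinarith [mul_pos (sub_pos.2 hkR) (sub_pos.2 hkR)]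
    calc δ * (3 * k ^ 2 * V) * (R - k) = (δ * V) * (3 * k ^ 2 * (R - k)) := by ring
      _ ≤ (δ * V) * (R ^ 3 - k ^ 3) := mul_le_mul_of_nonneg_left this (by positivity)
      _ = _ := by ring
  have ht := (hasDerivWithinAt_iff_tendsto_slope' (s := Set.Ioi k) (by simp)).1 hd.hasDerivWithinAt
  have := ge_of_tendsto ht hlow
  refine lt_of_lt_of_le ?_ this
  positivity

lemma sinc_form_pos (N : ℕ) (y : Fin N → R3) (hy : Function.Injective y)
    (a : Fin N → ℝ) (ha : a ≠ 0) (k : ℝ) (hk : 0 < k) :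
    0 < ∑ j, ∑ l, a j * a l * Real.sinc (k * ‖y j - y l‖) := by
  obtain ⟨ξ₀, hξ, hne⟩ := exists_sphere_ne N y hy a ha k hk
  let W : R3 → ℝ := fun ξ => ∑ j, ∑ l, a j * a l * Real.cos (inner ℝ (y j - y l) ξ)
  have hW : ∀ ξ, W ξ = (∑ j, a j * Real.cos (inner ℝ (y j) ξ)) ^ 2 +
      (∑ j, a j * Real.sin (inner ℝ (y j) ξ)) ^ 2 := by
    intro ξ
    simp only [W, sq, Finset.sum_mul_sum, ← Finset.sum_add_distrib]
    refine Finset.sum_congr rfl fun j _ => Finset.sum_congr rfl fun l _ => ?_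
    rw [inner_sub_left, Real.cos_sub]
    ring
  have hWpos : 0 < W ξ₀ := by
    by_contra hcon
    rw [hW] at hcon
    apply hne
    have s1 := sq_nonneg (∑ j, a j * Real.cos (inner ℝ (y j) ξ₀))
    have s2 := sq_nonneg (∑ j, a j * Real.sin (inner ℝ (y j) ξ₀))
    have h1 : ∑ j, a j * Real.cos (inner ℝ (y j) ξ₀) = 0 := by
      refine pow_eq_zero_iff two_ne_zero |>.1 ?_; linarith
    have h2 : ∑ j, a j * Real.sin (inner ℝ (y j) ξ₀) = 0 := by
      refine pow_eq_zero_iff two_ne_zero |>.1 ?_; linarith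
    have : ∑ j, (a j : ℂ) * Complex.exp (Complex.I * (inner ℝ (y j) ξ₀ : ℝ)) =
      ((∑ j, a j * Real.cos (inner ℝ (y j) ξ₀) : ℝ) : ℂ) +
      ((∑ j, a j * Real.sin (inner ℝ (y j) ξ₀) : ℝ) : ℂ) * I := by
      push_cast
      rw [Finset.sum_mul, ← Finset.sum_add_distrib]
      refine Finset.sum_congr rfl fun j _ => ?_
      rw [mul_comm I, Complex.exp_mul_I]
      ring
    rw [this, h1, h2]
    simp
  have hD : HasDerivAt (fun R => ∫ ξ in Metric.ball (0 : R3) R, W ξ)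
      (∑ j, ∑ l, a j * a l * (4 * Real.pi * k ^ 2 * Real.sinc (k * ‖y j - y l‖))) k := by
    have hc : ∀ x : R3, Continuous fun ξ : R3 => Real.cos (inner ℝ x ξ) := fun x => by fun_prop
    have hint : ∀ R, ∀ x : R3, IntegrableOn (fun ξ : R3 => Real.cos (inner ℝ x ξ)) (Metric.ball 0 R) :=
      fun R x =>
      ((hc x).continuousOn.integrableOn_compact (isCompact_closedBall (0 : R3) R)).mono_set
        Metric.ball_subset_closedBall
    have e : (fun R => ∫ ξ in Metric.ball (0 : R3) R, W ξ) = fun R => ∑ j, ∑ l, a j * a l *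
        ∫ ξ in Metric.ball (0 : R3) R, Real.cos (inner ℝ (y j - y l) ξ) := by
      funext R
      simp only [W]
      rw [integral_finsetSum _ fun j _ => integrable_finsetSum _ fun l _ => (hint R _).const_mul _]
      refine Finset.sum_congr rfl fun j _ => ?_
      rw [integral_finsetSum _ fun l _ => (hint R _).const_mul _]
      refine Finset.sum_congr rfl fun l _ => ?_
      rw [integral_const_mul]
    rw [e]
    exact HasDerivAt.fun_sum fun j _ => HasDerivAt.fun_sum fun l _ =>
      (hasDerivAt_cos_ball (y j - y l) k hk).const_mul _
  have := deriv_ball_pos W (by fun_prop) (fun ξ => by rw [hW]; positivity) k hk ξ₀ hξ hWpos _ hD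
  have e : ∑ j, ∑ l, a j * a l * (4 * Real.pi * k ^ 2 * Real.sinc (k * ‖y j - y l‖)) =
      4 * Real.pi * k ^ 2 * ∑ j, ∑ l, a j * a l * Real.sinc (k * ‖y j - y l‖) := by
    simp only [Finset.mul_sum]
    refine Finset.sum_congr rfl fun j _ => Finset.sum_congr rfl fun l _ => ?_
    ring
  rw [e] at this
  exact (mul_pos_iff_of_pos_left (by positivity)).1 this

/-- For distinct points `y₁,…,y_N ⊂ ℝ³`, real parameters `α`, and every
real `k > 0`, the matrix `Γ_{α,Y}(k)` with entries
`(α j - ik/(4π)) δ_{jℓ} - (e^{ik|y_j-y_ℓ|}/(4π|y_j-y_ℓ|)) (1-δ_{jℓ})` is invertible. -/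
theorem gamma_matrix_invertible (N : ℕ) (y : Fin N → R3) (hy : Function.Injective y)
    (α : Fin N → ℝ) (k : ℝ) (hk : 0 < k) :
    (Matrix.of fun j ℓ : Fin N =>
        (if j = ℓ then (α j : ℂ) - Complex.I * (k : ℂ) / (4 * (Real.pi : ℂ)) else 0)
          - (if j = ℓ then 0
             else Complex.exp (Complex.I * (k : ℂ) * (‖y j - y ℓ‖ : ℝ)) /
               (4 * (Real.pi : ℂ) * (‖y j - y ℓ‖ : ℝ)))).det ≠ 0 := by
  intro hdet
  obtain ⟨v, hv, hMv⟩ := Matrix.exists_mulVec_eq_zero_iff.2 hdet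
  set M : Matrix (Fin N) (Fin N) ℂ := Matrix.of _ with hM
  have him : ∀ j l, (M j l).im = -(k / (4 * Real.pi)) * Real.sinc (k * ‖y j - y l‖) := by
    intro j l
    simp only [hM, Matrix.of_apply]
    by_cases h : j = l
    · subst h
      have : (α j : ℂ) - I * k / (4 * Real.pi) = (α j : ℂ) - ((k / (4 * Real.pi) : ℝ) : ℂ) * I := by
        push_cast; ring
      simp only [if_true, this, sub_zero]
      rw [Complex.sub_im, Complex.ofReal_im, Complex.im_ofReal_mul]
      simp
    · have hr : ‖y j - y l‖ ≠ 0 := norm_ne_zero_iff.2 (sub_ne_zero.2 fun e => h (hy e))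
      have e1 : Complex.exp (I * k * (‖y j - y l‖ : ℝ)) / (4 * Real.pi * (‖y j - y l‖ : ℝ)) =
          (((4 * Real.pi * ‖y j - y l‖)⁻¹ : ℝ) : ℂ) *
            Complex.exp (((k * ‖y j - y l‖ : ℝ) : ℂ) * I) := by
        push_cast
        rw [div_eq_inv_mul]
        congr 2
        ring
      rw [if_neg h, if_neg h, e1, zero_sub, Complex.neg_im, Complex.im_ofReal_mul,
        Complex.exp_ofReal_mul_I_im, Real.sinc_of_ne_zero (mul_ne_zero hk.ne' hr)]
      field_simp
  have hsym : ∀ j l, M j l = M l j := by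
    intro j l
    simp only [hM, Matrix.of_apply]
    by_cases h : j = l
    · subst h; rfl
    · rw [if_neg h, if_neg h, if_neg (Ne.symm h), if_neg (Ne.symm h), norm_sub_rev]
  have h0 : (∑ j, ∑ l, (starRingEnd ℂ) (v j) * (M j l * v l)).im = 0 := by
    have : ∑ j, ∑ l, (starRingEnd ℂ) (v j) * (M j l * v l) = 0 := by
      refine Finset.sum_eq_zero fun j _ => ?_
      rw [← Finset.mul_sum]
      have := congrFun hMv j
      simp only [Matrix.mulVec, dotProduct, Pi.zero_apply] at this
      rw [this, mul_zero]
    rw [this, Complex.zero_im]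
  let Q : (Fin N → ℝ) → ℝ := fun a => ∑ j, ∑ l, a j * a l * Real.sinc (k * ‖y j - y l‖)
  have hanti : ∑ j, ∑ l, (M j l).re * ((v j).re * (v l).im - (v j).im * (v l).re) = 0 := by
    have : ∑ j, ∑ l, (M j l).re * ((v j).re * (v l).im - (v j).im * (v l).re) =
        -∑ j, ∑ l, (M j l).re * ((v j).re * (v l).im - (v j).im * (v l).re) := by
      conv_lhs => rw [Finset.sum_comm]
      rw [← Finset.sum_neg_distrib]
      refine Finset.sum_congr rfl fun j _ => ?_
      rw [← Finset.sum_neg_distrib]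
      refine Finset.sum_congr rfl fun l _ => ?_
      rw [hsym l j]
      ring
    linarith
  have hQ : (∑ j, ∑ l, (starRingEnd ℂ) (v j) * (M j l * v l)).im =
      -(k / (4 * Real.pi)) * (Q (fun j => (v j).re) + Q (fun j => (v j).im)) +
      ∑ j, ∑ l, (M j l).re * ((v j).re * (v l).im - (v j).im * (v l).re) := by
    simp only [Q, Complex.im_sum, Finset.mul_sum, ← Finset.sum_add_distrib]
    refine Finset.sum_congr rfl fun j _ => Finset.sum_congr rfl fun l _ => ?_
    simp only [Complex.mul_im, Complex.mul_re, Complex.conj_re, Complex.conj_im]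
    rw [him]
    ring
  rw [h0, hanti, add_zero] at hQ
  have hc : k / (4 * Real.pi) ≠ 0 := by positivity
  have hsum : Q (fun j => (v j).re) + Q (fun j => (v j).im) = 0 := by
    rcases mul_eq_zero.1 hQ.symm with h | h
    · exact absurd (neg_eq_zero.1 h) hc
    · exact h
  have hpos : ∀ a, a ≠ 0 → 0 < Q a := fun a ha => sinc_form_pos N y hy a ha k hk
  have hnn : ∀ a, 0 ≤ Q a := fun a => by
    by_cases ha : a = 0
    · simp [ha, Q]
    · exact (hpos a ha).le
  have hre : (fun j => (v j).re) = 0 := by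
    by_contra h
    linarith [hpos _ h, hnn (fun j => (v j).im)]
  have him0 : (fun j => (v j).im) = 0 := by
    by_contra h
    linarith [hpos _ h, hnn (fun j => (v j).re)]
  apply hv
  funext j
  exact Complex.ext (congrFun hre j) (congrFun him0 j)
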